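/- Let A be an abelian category and let 0 ⟶ F →i M →d C ⟶ 0 be a fully invariant short exact sequence in A. Then M is self-F-split if and only if for every monomorphism k : K ⟶ F, the quotient M/K is self-(F/K)-split; here, writing p : M ⟶ M/K for the cokernel of i ∘ k and f : F ⟶ F/K for the cokernel of k, the induced monomorphism i' : F/K ⟶ M/K satisfying i' ∘ f = p ∘ i is fully invariant, and M/K is self-(F/K)-split means that for every morphism g : M/K ⟶ M/K the kernel of d' ∘ g is a split monomorphism, where d' : M/K ⟶ C is the cokernel of i'. -/

import Mathlib

open CategoryTheory CategoryTheory.Limits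

universe v u

/-- A monomorphism `i : F ⟶ M` is *fully invariant* if for each endomorphism
`h : M ⟶ M` there is `α : F ⟶ F` with `h ∘ i = i ∘ α`. -/
def FullyInvariant {A : Type u} [Category.{v} A] {F M : A} (i : F ⟶ M) : Prop :=
  ∀ h : M ⟶ M, ∃ α : F ⟶ F, i ≫ h = α ≫ i

/-- The kernel of `φ` is a split monomorphism iff `φ` is annihilated by an endomorphism fixing
every morphism annihilated by `φ`. -/
lemma isSplitMono_kernel_ι_iff {A : Type u} [Category.{v} A] [Abelian A] {X Y : A} (φ : X ⟶ Y) :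
    IsSplitMono (kernel.ι φ) ↔
      ∃ e : X ⟶ X, e ≫ φ = 0 ∧ ∀ (Z : A) (x : Z ⟶ X), x ≫ φ = 0 → x ≫ e = x := by
  constructor
  · intro h
    refine ⟨retraction (kernel.ι φ) ≫ kernel.ι φ, by simp, fun Z x hx => ?_⟩
    rw [← kernel.lift_ι φ x hx]
    simp only [Category.assoc, IsSplitMono.id_assoc]
  · rintro ⟨e, he, h⟩
    refine IsSplitMono.mk' ⟨kernel.lift φ e he, ?_⟩
    rw [← cancel_mono (kernel.ι φ)]
    simpa using h _ (kernel.ι φ) (kernel.condition φ)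

/-- Splitness of the kernel only depends on which morphisms are annihilated. -/
lemma isSplitMono_kernel_ι_of_iso {A : Type u} [Category.{v} A] [Abelian A] {X X' Y Y' : A}
    (p : X ⟶ X') [IsIso p] (φ : X ⟶ Y) (φ' : X' ⟶ Y') (a : Y ⟶ Y') (b : Y' ⟶ Y)
    (ha : φ ≫ a = p ≫ φ') (hb : p ≫ φ' ≫ b = φ) (h : IsSplitMono (kernel.ι φ')) :
    IsSplitMono (kernel.ι φ) := by
  rw [isSplitMono_kernel_ι_iff] at h ⊢
  obtain ⟨e, he, hfix⟩ := h
  refine ⟨p ≫ e ≫ inv p, ?_, fun Z x hx => ?_⟩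
  · rw [← hb]
    simp [reassoc_of% he]
  · have := hfix Z (x ≫ p) (by rw [Category.assoc, ← ha, reassoc_of% hx, zero_comp])
    rw [Category.assoc] at this
    rw [reassoc_of% this]
    simp

/-- A fully invariant split subobject admits no nonzero morphism to its complement. -/
lemma FullyInvariant.eq_zero {A : Type u} [Category.{v} A] [Abelian A] {F M C : A}
    {i : F ⟶ M} (hi : FullyInvariant i) {d : M ⟶ C} (w : i ≫ d = 0) {r : M ⟶ F} {s : C ⟶ M}
    (hr : i ≫ r = 𝟙 F) (hs : s ≫ d = 𝟙 C) (φ : F ⟶ C) : φ = 0 := by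
  obtain ⟨α, hα⟩ := hi (r ≫ φ ≫ s)
  have h := hα =≫ d
  simpa [reassoc_of% hr, hs, w] using h

/-- If `M = F ⊕ C` with `F` fully invariant and `M` is self-`F`-split, then every
`M' = F' ⊕ C` with `F'` a quotient of `F` is self-`F'`-split, with `F'` fully invariant. -/
lemma selfSplit_of_epi {A : Type u} [Category.{v} A] [Abelian A] {F M C F' M' : A}
    {i : F ⟶ M} {d : M ⟶ C} (w : i ≫ d = 0) (hi : FullyInvariant i)
    {r : M ⟶ F} {s : C ⟶ M} (hr : i ≫ r = 𝟙 F) (hs : s ≫ d = 𝟙 C)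
    (hM : ∀ g : M ⟶ M, IsSplitMono (kernel.ι (g ≫ d)))
    (f : F ⟶ F') [Epi f] {i' : F' ⟶ M'} {d' : M' ⟶ C} (w' : i' ≫ d' = 0)
    {r' : M' ⟶ F'} {s' : C ⟶ M'} (hs' : s' ≫ d' = 𝟙 C)
    (hsum : r' ≫ i' + d' ≫ s' = 𝟙 M') :
    FullyInvariant i' ∧
      ∀ g : M' ⟶ M', IsSplitMono (kernel.ι (g ≫ cokernel.π i')) := by
  have hzero (φ : F' ⟶ C) : φ = 0 := by
    rw [← cancel_epi f, comp_zero]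
    exact hi.eq_zero w hr hs _
  refine ⟨fun h => ⟨i' ≫ h ≫ r', ?_⟩, fun g => ?_⟩
  · have h0 : i' ≫ h ≫ d' = 0 := hzero _
    have h1 := (i' ≫ h) ≫= hsum
    simpa [reassoc_of% h0] using h1.symm
  · have hπ : d' ≫ s' ≫ cokernel.π i' = cokernel.π i' := by
      have := hsum =≫ cokernel.π i'
      simpa using this
    have hg : g ≫ d' = d' ≫ s' ≫ g ≫ d' := by
      have h0 : i' ≫ g ≫ d' = 0 := hzero _
      have := hsum =≫ (g ≫ d')
      simpa [h0] using this.symm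
    have hd : cokernel.π i' ≫ cokernel.desc i' d' w' = d' := cokernel.π_desc _ _ _
    obtain ⟨e, he, hfix⟩ :=
      (isSplitMono_kernel_ι_iff _).1 (hM (d ≫ (s' ≫ g ≫ d') ≫ s))
    simp only [Category.assoc, hs, Category.comp_id] at he hfix
    refine (isSplitMono_kernel_ι_iff _).2
      ⟨r' ≫ i' + d' ≫ s ≫ e ≫ d ≫ s', ?_, fun Z x hx => ?_⟩
    · rw [← hπ, reassoc_of% hg]
      simp [reassoc_of% w', reassoc_of% hs', reassoc_of% he]
    · have hx' : x ≫ g ≫ d' = 0 := by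
        have := hx =≫ cokernel.desc i' d' w'
        simpa [hd] using this
      have hxe := hfix Z (x ≫ d' ≫ s) (by
        simp only [Category.assoc, reassoc_of% hs]
        rw [← hg, hx'])
      simp only [Category.assoc] at hxe
      have h1 := x ≫= hsum
      simp only [Preadditive.comp_add, Category.comp_id] at h1 ⊢
      rw [reassoc_of% hxe, reassoc_of% hs, h1]

/-- Let `0 ⟶ F ⟶ M ⟶ C ⟶ 0` be a fully invariant short exact sequence.
Then `M` is self-`F`-split iff for every monomorphism `k : K ⟶ F` the quotient
`M/K = cokernel (k ≫ i)` is self-`(F/K)`-split: writing `p` and `f` for the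
cokernel projections of `k ≫ i` and `k` respectively, the induced monomorphism
`i' : F/K ⟶ M/K` (with `f ≫ i' = i ≫ p`) is fully invariant, and for every
`g : M/K ⟶ M/K` the kernel of `d' ∘ g` is a split monomorphism, where `d'` is
the cokernel of `i'`. -/
theorem stmt_15 {A : Type u} [Category.{v} A] [Abelian A] {F M C : A}
    (i : F ⟶ M) (d : M ⟶ C) (w : i ≫ d = 0)
    (hse : (ShortComplex.mk i d w).ShortExact) (hi : FullyInvariant i) :
    (∀ g : M ⟶ M, IsSplitMono (kernel.ι (g ≫ d))) ↔
      ∀ (K : A) (k : K ⟶ F), Mono k →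
        ∀ i' : cokernel k ⟶ cokernel (k ≫ i),
          cokernel.π k ≫ i' = i ≫ cokernel.π (k ≫ i) →
            FullyInvariant i' ∧
              ∀ g : cokernel (k ≫ i) ⟶ cokernel (k ≫ i),
                IsSplitMono (kernel.ι (g ≫ cokernel.π i')) := by
  have : Mono i := hse.mono_f
  have : Epi d := hse.epi_g
  constructor
  · intro hM K k _ i' hi'
    obtain ⟨e, he, hfix⟩ := (isSplitMono_kernel_ι_iff _).1 (hM (𝟙 M))
    simp only [Category.id_comp] at he hfix
    have hlift : hse.exact.lift e he ≫ i = e := hse.exact.lift_f e he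
    have hr : i ≫ hse.exact.lift e he = 𝟙 F := by
      rw [← cancel_mono i, Category.assoc, hlift, hfix F i w, Category.id_comp]
    let σ : (ShortComplex.mk i d w).Splitting :=
      ShortComplex.Splitting.ofExactOfRetraction _ hse.exact _ hr hse.epi_g
    obtain ⟨r, s, hr, hs, hsum⟩ : ∃ (r : M ⟶ F) (s : C ⟶ M), i ≫ r = 𝟙 F ∧ s ≫ d = 𝟙 C ∧
        r ≫ i + d ≫ s = 𝟙 M := ⟨σ.r, σ.s, σ.f_r, σ.s_g, σ.id⟩
    refine selfSplit_of_epi w hi hr hs hM (cokernel.π k)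
      (d' := cokernel.desc (k ≫ i) d (by simp [w]))
      (r' := cokernel.desc (k ≫ i) (r ≫ cokernel.π k) (by simp [reassoc_of% hr]))
      (s' := s ≫ cokernel.π (k ≫ i)) ?_ (by simp [hs]) ?_
    · rw [← cancel_epi (cokernel.π k), reassoc_of% hi']
      simp [w]
    · rw [← cancel_epi (cokernel.π (k ≫ i))]
      have := hsum =≫ cokernel.π (k ≫ i)
      simpa [hi'] using this
  · intro h g
    obtain ⟨Z, hZ⟩ := HasZeroObject.zero (C := A)
    let k : Z ⟶ F := 0
    have hp : k ≫ i = 0 := zero_comp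
    have : IsIso (cokernel.π (k ≫ i)) := by
      rw [hp]; infer_instance
    let i' : cokernel k ⟶ cokernel (k ≫ i) :=
      cokernel.desc k (i ≫ cokernel.π (k ≫ i)) (by rw [← Category.assoc, cokernel.condition])
    have hi' : cokernel.π k ≫ i' = i ≫ cokernel.π (k ≫ i) := cokernel.π_desc _ _ _
    have hsplit := (h Z k (hZ.mono k) i' hi').2
      (inv (cokernel.π (k ≫ i)) ≫ g ≫ cokernel.π (k ≫ i))
    obtain ⟨a, ha⟩ : ∃ a : C ⟶ cokernel i', d ≫ a = cokernel.π (k ≫ i) ≫ cokernel.π i' :=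
      ⟨hse.exact.desc (cokernel.π (k ≫ i) ≫ cokernel.π i')
        (by change i ≫ _ = 0; rw [← Category.assoc, ← hi']; simp), hse.exact.g_desc _ _⟩
    have hd : i' ≫ inv (cokernel.π (k ≫ i)) ≫ d = 0 := by
      rw [← cancel_epi (cokernel.π k), reassoc_of% hi']
      simp [w]
    exact isSplitMono_kernel_ι_of_iso (cokernel.π (k ≫ i)) _ _ a
      (cokernel.desc i' _ hd) (by simp [ha]) (by simp) hsplit
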